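/- Fix an integer δ. Then, as ℓ → ∞ through the positive integers (with ℓ + δ ≥ 1), one has lim_{ℓ→∞} ℓ · (P(ℓ, ℓ + δ) − 1/2) = δ/π. -/

import Mathlib

open MeasureTheory Real Filter

/-- Modified Bessel function of the first kind, integer order, defined by its series. -/
noncomputable def besselI (n : ℕ) (x : ℝ) : ℝ :=
  ∑' m : ℕ, (x / 2) ^ (n + 2 * m) / ((m.factorial : ℝ) * ((n + m).factorial : ℝ))

/-- Probability that walker `A` first reaches site `a` before walker `B` first reaches `b`. -/
noncomputable def Pfirst (a b : ℕ) : ℝ :=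
  (a : ℝ) * (b : ℝ) * ∫ tA in Set.Ioi (0 : ℝ),
    (Real.exp (-tA) * besselI a tA / tA) *
      ∫ tB in Set.Ioi tA, Real.exp (-tB) * besselI b tB / tB

open scoped Topology

/-- Probability that the rate-one symmetric walk on `ℤ` started at `0` is at `n` at time `t`. -/
noncomputable def walkProb (n : ℤ) (t : ℝ) : ℝ :=
  (1 / π) * ∫ θ in (0 : ℝ)..π, exp (-(t * (1 - cos θ))) * cos (n * θ)

lemma integral_cos_int_mul (k : ℤ) :
    ∫ θ in (0 : ℝ)..π, cos (k * θ) = if k = 0 then π else 0 := by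
  split_ifs with hk
  · simp [hk]
  · have hk' : (k : ℝ) ≠ 0 := by exact_mod_cast hk
    rw [intervalIntegral.integral_comp_mul_left (fun x => cos x) hk']
    simp

lemma hasSum_mul_of_summable_norms {f g : ℕ → ℂ} {a b : ℂ} (hf : HasSum f a) (hg : HasSum g b)
    (hf' : Summable fun n => ‖f n‖) (hg' : Summable fun n => ‖g n‖) :
    HasSum (fun p : ℕ × ℕ => f p.1 * g p.2) (a * b) :=
  hf.mul hg (summable_mul_of_summable_norm hf' hg')

lemma hasSum_exp_mul_exp_mul (x y w : ℂ) :
    HasSum (fun p : ℕ × ℕ => x ^ p.1 / (p.1.factorial : ℂ) * (y ^ p.2 / (p.2.factorial : ℂ)) *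
      Complex.exp w) (Complex.exp (x + y + w)) := by
  have hn (z : ℂ) : Summable fun n : ℕ => ‖z ^ n / (n.factorial : ℂ)‖ :=
    NormedSpace.norm_expSeries_div_summable z
  have hs (z : ℂ) : HasSum (fun n : ℕ => z ^ n / (n.factorial : ℂ)) (Complex.exp z) := by
    rw [Complex.exp_eq_exp_ℂ]
    exact NormedSpace.expSeries_div_hasSum_exp z
  rw [Complex.exp_add, Complex.exp_add]
  exact (hasSum_mul_of_summable_norms (f := fun n => x ^ n / (n.factorial : ℂ))
    (g := fun n => y ^ n / (n.factorial : ℂ)) (hs x) (hs y) (hn x) (hn y)).mul_right _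

lemma hasSum_exp_mul_cos (n : ℕ) (t θ : ℝ) :
    HasSum (fun p : ℕ × ℕ => (t / 2) ^ p.1 / (p.1.factorial : ℝ) *
        ((t / 2) ^ p.2 / (p.2.factorial : ℝ)) * cos (((p.1 : ℤ) - p.2 - n : ℤ) * θ))
      (exp (t * cos θ) * cos (n * θ)) := by
  have h := hasSum_exp_mul_exp_mul ((t / 2 : ℂ) * Complex.exp (θ * Complex.I))
    ((t / 2 : ℂ) * Complex.exp (-(θ * Complex.I))) (-(n * θ * Complex.I))
  have hterm (p : ℕ × ℕ) : ((t / 2 : ℂ) * Complex.exp (θ * Complex.I)) ^ p.1 /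
        (p.1.factorial : ℂ) *
      (((t / 2 : ℂ) * Complex.exp (-(θ * Complex.I))) ^ p.2 / (p.2.factorial : ℂ)) *
        Complex.exp (-(n * θ * Complex.I)) =
      (((t / 2) ^ p.1 / (p.1.factorial : ℝ) * ((t / 2) ^ p.2 / (p.2.factorial : ℝ)) : ℝ) : ℂ) *
        Complex.exp (((((p.1 : ℤ) - p.2 - n : ℤ) * θ : ℝ) : ℂ) * Complex.I) := by
    have e : Complex.exp (((((p.1 : ℤ) - p.2 - n : ℤ) * θ : ℝ) : ℂ) * Complex.I) =
        Complex.exp (θ * Complex.I) ^ p.1 * Complex.exp (-(θ * Complex.I)) ^ p.2 *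
          Complex.exp (-(n * θ * Complex.I)) := by
      rw [← Complex.exp_nat_mul, ← Complex.exp_nat_mul, ← Complex.exp_add, ← Complex.exp_add]
      congr 1
      push_cast
      ring
    rw [e, mul_pow, mul_pow]
    push_cast
    ring
  have hsum : (t / 2 : ℂ) * Complex.exp (θ * Complex.I) +
      (t / 2 : ℂ) * Complex.exp (-(θ * Complex.I)) + -(n * θ * Complex.I) =
      ((t * cos θ : ℝ) : ℂ) + ((-(n * θ) : ℝ) : ℂ) * Complex.I := by
    push_cast
    rw [Complex.cos, neg_mul]
    ring
  rw [hsum, Complex.exp_add, ← Complex.ofReal_exp] at h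
  simp only [hterm] at h
  have h2 := Complex.hasSum_re h
  simpa only [Complex.re_ofReal_mul, Complex.exp_ofReal_mul_I_re, cos_neg] using h2

lemma integral_exp_mul_cos (n : ℕ) (t : ℝ) :
    ∫ θ in (0 : ℝ)..π, exp (t * cos θ) * cos (n * θ) = π * besselI n t := by
  set c : ℕ × ℕ → ℝ := fun p => (t / 2) ^ p.1 / (p.1.factorial : ℝ) *
        ((t / 2) ^ p.2 / (p.2.factorial : ℝ)) with hc
  have hsum : Summable fun p => ‖c p‖ := by
    have h := NormedSpace.norm_expSeries_div_summable (t / 2)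
    exact (summable_mul_of_summable_norm h h).norm
  have h := intervalIntegral.hasSum_integral_of_dominated_convergence (μ := volume)
    (a := 0) (b := π) (F := fun p θ => c p * cos (((p.1 : ℤ) - p.2 - n : ℤ) * θ))
    (f := fun θ => exp (t * cos θ) * cos (n * θ)) (fun p _ => ‖c p‖)
    (fun p => (by fun_prop : Continuous _).aestronglyMeasurable)
    (fun p => ae_of_all _ fun θ _ => by
      rw [norm_mul]
      exact mul_le_of_le_one_right (norm_nonneg _) (by simpa using abs_cos_le_one _))
    (ae_of_all _ fun θ _ => hsum) (by simp)
    (ae_of_all _ fun θ _ => hasSum_exp_mul_cos n t θ)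
  simp only [intervalIntegral.integral_const_mul, integral_cos_int_mul] at h
  have hinj : Function.Injective (fun m : ℕ => ((n + m, m) : ℕ × ℕ)) := fun a b hab => by
    simpa using congrArg Prod.snd hab
  rw [← hinj.hasSum_iff] at h
  · rw [← h.tsum_eq, besselI, ← tsum_mul_left]
    congr 1
    ext m
    simp only [Function.comp_apply, hc]
    rw [if_pos (by push_cast; ring)]
    ring
  · rintro ⟨i, j⟩ hij
    rw [if_neg, mul_zero]
    intro h0
    apply hij
    exact ⟨j, by ext <;> simp; omega⟩

lemma exp_neg_mul_besselI (n : ℕ) (t : ℝ) : exp (-t) * besselI n t = walkProb n t := by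
  have h := integral_exp_mul_cos n t
  rw [walkProb]
  have : ∀ θ : ℝ, exp (-(t * (1 - cos θ))) * cos ((n : ℤ) * θ) =
      exp (-t) * (exp (t * cos θ) * cos (n * θ)) := fun θ => by
    rw [← mul_assoc, ← exp_add]
    push_cast
    ring_nf
  simp only [this, intervalIntegral.integral_const_mul, h]
  field_simp

lemma besselI_nonneg (n : ℕ) {t : ℝ} (ht : 0 ≤ t) : 0 ≤ besselI n t :=
  tsum_nonneg fun _ => by positivity

lemma walkProb_at_zero (n : ℤ) : walkProb n 0 = if n = 0 then 1 else 0 := by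
  simp only [walkProb, zero_mul, neg_zero, exp_zero, one_mul, integral_cos_int_mul]
  split_ifs
  · field_simp
  · simp

lemma walkProb_neg (n : ℤ) (t : ℝ) : walkProb (-n) t = walkProb n t := by
  simp [walkProb]

lemma abs_walkProb_le_one (n : ℤ) {t : ℝ} (ht : 0 ≤ t) : |walkProb n t| ≤ 1 := by
  have h : ‖∫ θ in (0 : ℝ)..π, exp (-(t * (1 - cos θ))) * cos (n * θ)‖ ≤ 1 * |π - 0| := by
    refine intervalIntegral.norm_integral_le_of_norm_le_const fun θ _ => ?_
    rw [norm_mul, ← one_mul (1 : ℝ)]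
    refine mul_le_mul ?_ (by simpa using abs_cos_le_one _) (norm_nonneg _) zero_le_one
    rw [norm_of_nonneg (exp_pos _).le, exp_le_one_iff]
    nlinarith [cos_le_one θ]
  rw [sub_zero, abs_of_pos pi_pos, one_mul] at h
  rw [walkProb, abs_mul, abs_of_pos (by positivity), one_div, inv_mul_le_iff₀ pi_pos, mul_one]
  exact h

lemma tendsto_walkProb_atTop (n : ℤ) : Tendsto (walkProb n) atTop (𝓝 0) := by
  have h : Tendsto (fun t : ℝ => ∫ θ in (0 : ℝ)..π, exp (-(t * (1 - cos θ))) * cos (n * θ))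
      atTop (𝓝 (∫ θ in (0 : ℝ)..π, (0 : ℝ))) := by
    refine intervalIntegral.tendsto_integral_filter_of_dominated_convergence (fun _ => 1)
      (.of_forall fun t => (by fun_prop : Continuous _).aestronglyMeasurable) ?_ (by simp) ?_
    · filter_upwards [eventually_ge_atTop 0] with t ht
      refine ae_of_all _ fun θ _ => ?_
      rw [norm_mul, ← one_mul (1 : ℝ)]
      refine mul_le_mul ?_ (by simpa using abs_cos_le_one _) (norm_nonneg _) zero_le_one
      rw [norm_of_nonneg (exp_pos _).le, exp_le_one_iff]
      nlinarith [cos_le_one θ]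
    · refine ae_of_all _ fun θ hθ => ?_
      rw [Set.uIoc_of_le pi_pos.le] at hθ
      have hc : 0 < 1 - cos θ := by
        have := cos_lt_cos_of_nonneg_of_le_pi le_rfl hθ.2 hθ.1
        rw [cos_zero] at this
        linarith
      have := (tendsto_exp_neg_atTop_nhds_zero.comp (tendsto_id.atTop_mul_const hc)).mul_const
        (cos (n * θ))
      simpa using this
  have := h.const_mul (1 / π)
  rwa [intervalIntegral.integral_zero, mul_zero] at this

lemma hasDerivAt_walkProb (n : ℤ) (t : ℝ) :
    HasDerivAt (walkProb n) ((walkProb (n - 1) t + walkProb (n + 1) t) / 2 - walkProb n t) t := by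
  have h := (intervalIntegral.hasDerivAt_integral_of_dominated_loc_of_deriv_le
    (μ := volume) (a := 0) (b := π)
    (F := fun (t θ : ℝ) => exp (-(t * (1 - cos θ))) * cos (n * θ))
    (F' := fun (t θ : ℝ) => exp (-(t * (1 - cos θ))) * (-(1 - cos θ)) * cos (n * θ))
    (x₀ := t) (s := Metric.ball t 1) (bound := fun _ => exp ((|t| + 1) * 2) * 2)
    (Metric.ball_mem_nhds t one_pos)
    (.of_forall fun t => (by fun_prop : Continuous _).aestronglyMeasurable)
    ((by fun_prop : Continuous _).intervalIntegrable _ _)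
    (by fun_prop : Continuous _).aestronglyMeasurable
    (ae_of_all _ fun θ _ x hx => by
      have h1 := cos_le_one θ
      have h2 := neg_one_le_cos θ
      have hx' : |x| ≤ |t| + 1 := by
        have h3 := (abs_sub_abs_le_abs_sub x t)
        rw [Metric.mem_ball, dist_eq] at hx
        linarith
      rw [norm_mul, norm_mul, norm_of_nonneg (exp_pos _).le, norm_neg, norm_of_nonneg (by linarith)]
      refine (mul_le_of_le_one_right (by have := exp_pos (-(x * (1 - cos θ))); nlinarith)
        (by simpa using abs_cos_le_one _)).trans ?_
      gcongr
      · nlinarith [neg_abs_le x, abs_nonneg x]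
      · linarith)
    (by simp)
    (ae_of_all _ fun θ _ x _ => by
      have := (((hasDerivAt_id x).mul_const (1 - cos θ)).neg.exp).mul_const (cos (n * θ))
      simpa using this)).2.const_mul (1 / π)
  convert! h using 1
  simp only [walkProb]
  have hi (m : ℤ) : IntervalIntegrable (fun θ => exp (-(t * (1 - cos θ))) * cos (m * θ))
    volume 0 π := (by fun_prop : Continuous _).intervalIntegrable _ _
  rw [← mul_add, ← intervalIntegral.integral_add (hi _) (hi _), mul_div_assoc,
    ← intervalIntegral.integral_div, ← mul_sub,
    ← intervalIntegral.integral_sub (((hi _).add (hi _)).div_const _) (hi _)]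
  congr 1
  refine intervalIntegral.integral_congr fun θ _ => ?_
  have e1 : ((n - 1 : ℤ) : ℝ) * θ = n * θ - θ := by push_cast; ring
  have e2 : ((n + 1 : ℤ) : ℝ) * θ = n * θ + θ := by push_cast; ring
  simp only [e1, e2, cos_sub, cos_add]
  ring

lemma continuous_walkProb (n : ℤ) : Continuous (walkProb n) :=
  continuous_iff_continuousAt.2 fun t => (hasDerivAt_walkProb n t).continuousAt

/-- The identity `n I_n(t) = t (I_{n-1}(t) - I_{n+1}(t)) / 2`, damped by `exp (-t)`. -/
lemma mul_walkProb_eq (n : ℤ) (t : ℝ) :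
    n * walkProb n t = t * ((walkProb (n - 1) t - walkProb (n + 1) t) / 2) := by
  have hsin : sin (n * π) = 0 := sin_int_mul_pi n
  have hu (θ : ℝ) : HasDerivAt (fun θ => exp (-(t * (1 - cos θ))))
      (exp (-(t * (1 - cos θ))) * (-(t * sin θ))) θ := by
    have := (((hasDerivAt_cos θ).const_sub 1).const_mul t).neg.exp
    simpa using this
  have hv (θ : ℝ) : HasDerivAt (fun θ => sin (n * θ)) (n * cos (n * θ)) θ := by
    have := ((hasDerivAt_id θ).const_mul (n : ℝ)).sin
    simpa [mul_comm] using this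
  have h := intervalIntegral.integral_mul_deriv_eq_deriv_mul (a := 0) (b := π)
    (fun θ _ => hu θ) (fun θ _ => hv θ)
    ((by fun_prop : Continuous _).intervalIntegrable _ _)
    ((by fun_prop : Continuous _).intervalIntegrable _ _)
  simp only [hsin, mul_zero, sin_zero, sub_zero, zero_sub] at h
  have hi (m : ℤ) : IntervalIntegrable (fun θ => exp (-(t * (1 - cos θ))) * cos (m * θ))
    volume 0 π := (by fun_prop : Continuous _).intervalIntegrable _ _
  simp only [walkProb]
  rw [← mul_sub, ← intervalIntegral.integral_sub (hi _) (hi _), mul_div_assoc,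
    ← intervalIntegral.integral_div, mul_left_comm, mul_left_comm t]
  congr 1
  rw [← intervalIntegral.integral_const_mul, ← intervalIntegral.integral_const_mul]
  have h' : ∫ θ in (0 : ℝ)..π, (n : ℝ) * (exp (-(t * (1 - cos θ))) * cos (n * θ)) =
      ∫ θ in (0 : ℝ)..π, exp (-(t * (1 - cos θ))) * (n * cos (n * θ)) := by
    congr 1; ext θ; ring
  rw [h', h, ← intervalIntegral.integral_neg]
  refine intervalIntegral.integral_congr fun θ _ => ?_
  have e1 : ((n - 1 : ℤ) : ℝ) * θ = n * θ - θ := by push_cast; ring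
  have e2 : ((n + 1 : ℤ) : ℝ) * θ = n * θ + θ := by push_cast; ring
  simp only [e1, e2, cos_sub, cos_add]
  ring

/-- Density at time `t > 0` of the first passage time of the walk at the site `n ≥ 1`. -/
noncomputable def hitDensity (n : ℤ) (t : ℝ) : ℝ :=
  (walkProb (n - 1) t - walkProb (n + 1) t) / 2

/-- Probability that the walk has not reached the site `b` by time `t`. -/
noncomputable def survival (b : ℕ) (t : ℝ) : ℝ :=
  ∑ j ∈ Finset.range b, (walkProb j t + walkProb (j + 1) t)

lemma mul_exp_neg_mul_besselI_div (n : ℕ) {t : ℝ} (ht : t ≠ 0) :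
    n * (exp (-t) * besselI n t / t) = hitDensity n t := by
  rw [exp_neg_mul_besselI, ← mul_div_assoc, div_eq_iff ht]
  have := mul_walkProb_eq n t
  rw [hitDensity, mul_comm _ t]
  exact_mod_cast this

lemma continuous_hitDensity (n : ℤ) : Continuous (hitDensity n) :=
  ((continuous_walkProb _).sub (continuous_walkProb _)).div_const _

lemma hitDensity_nonneg (n : ℕ) {t : ℝ} (ht : 0 < t) : 0 ≤ hitDensity n t := by
  rw [← mul_exp_neg_mul_besselI_div n ht.ne']
  have := besselI_nonneg n ht.le
  positivity

lemma hitDensity_zero (t : ℝ) : hitDensity 0 t = 0 := by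
  have := walkProb_neg 1 t
  simp [hitDensity, this]

lemma tendsto_hitDensity_atTop (n : ℤ) : Tendsto (hitDensity n) atTop (𝓝 0) := by
  have h := ((tendsto_walkProb_atTop (n - 1)).sub (tendsto_walkProb_atTop (n + 1))).div_const 2
  rwa [sub_zero, zero_div] at h

lemma hasDerivAt_hitDensity (n : ℤ) (t : ℝ) :
    HasDerivAt (hitDensity n)
      ((hitDensity (n - 1) t + hitDensity (n + 1) t) / 2 - hitDensity n t) t := by
  have h := ((hasDerivAt_walkProb (n - 1) t).sub (hasDerivAt_walkProb (n + 1) t)).div_const 2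
  convert! h using 1
  simp only [hitDensity]
  ring_nf

lemma survival_succ (b : ℕ) (t : ℝ) :
    survival (b + 1) t = survival b t + (walkProb b t + walkProb (b + 1) t) := by
  rw [survival, Finset.sum_range_succ, survival]

lemma hasDerivAt_survival (b : ℕ) (t : ℝ) :
    HasDerivAt (survival b) (-hitDensity b t) t := by
  induction b with
  | zero =>
    have : survival 0 = fun _ => 0 := by ext; simp [survival]
    rw [this]
    simpa [hitDensity_zero] using hasDerivAt_const t (0 : ℝ)
  | succ b ih =>
    have h := ih.add ((hasDerivAt_walkProb b t).add (hasDerivAt_walkProb (b + 1) t))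
    have e : survival (b + 1) = survival b + (walkProb b + walkProb (b + 1)) :=
      funext fun t => survival_succ b t
    rw [e]
    convert! h using 1
    simp only [hitDensity]
    push_cast
    ring_nf

lemma tendsto_survival_atTop (b : ℕ) : Tendsto (survival b) atTop (𝓝 0) := by
  have h := tendsto_finsetSum (Finset.range b) fun j _ =>
    (tendsto_walkProb_atTop j).add (tendsto_walkProb_atTop (j + 1))
  simp only [add_zero, Finset.sum_const_zero] at h
  exact h

lemma survival_at_zero {b : ℕ} (hb : 1 ≤ b) : survival b 0 = 1 := by
  induction b, hb using Nat.le_induction with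
  | base => simp [survival, walkProb_at_zero]
  | succ b hb ih =>
    rw [survival_succ, ih, walkProb_at_zero, walkProb_at_zero, if_neg (by omega),
      if_neg (by omega)]
    simp

lemma integrableOn_hitDensity (b : ℕ) {a : ℝ} (ha : 0 ≤ a) :
    IntegrableOn (hitDensity b) (Set.Ioi a) := by
  have h := integrableOn_Ioi_deriv_of_nonpos' (a := a) (fun x _ => hasDerivAt_survival b x)
    (fun x hx => neg_nonpos.2 (hitDensity_nonneg b (ha.trans_lt hx))) (tendsto_survival_atTop b)
  simpa using h.neg

lemma integral_hitDensity (b : ℕ) {a : ℝ} (ha : 0 ≤ a) :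
    ∫ t in Set.Ioi a, hitDensity b t = survival b a := by
  have h := integral_Ioi_of_hasDerivAt_of_nonpos' (a := a) (fun x _ => hasDerivAt_survival b x)
    (fun x hx => neg_nonpos.2 (hitDensity_nonneg b (ha.trans_lt hx))) (tendsto_survival_atTop b)
  rw [integral_neg, zero_sub] at h
  exact neg_injective h

lemma integrableOn_hitDensity_mul (a : ℕ) {g : ℝ → ℝ} (hg : Continuous g) {C : ℝ}
    (hC : ∀ t, 0 < t → |g t| ≤ C) :
    IntegrableOn (fun t => hitDensity a t * g t) (Set.Ioi 0) :=
  (integrableOn_hitDensity a le_rfl).mul_bdd hg.aestronglyMeasurable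
    ((ae_restrict_mem measurableSet_Ioi).mono fun t ht => hC t ht)

lemma integrableOn_hitDensity_mul_walkProb (a : ℕ) (n : ℤ) :
    IntegrableOn (fun t => hitDensity a t * walkProb n t) (Set.Ioi 0) :=
  integrableOn_hitDensity_mul a (continuous_walkProb n) fun _ ht => abs_walkProb_le_one n ht.le

lemma integrableOn_hitDensity_mul_survival (a b : ℕ) :
    IntegrableOn (fun t => hitDensity a t * survival b t) (Set.Ioi 0) := by
  simp only [survival, Finset.mul_sum, mul_add]
  exact integrable_finsetSum _ fun j _ => (integrableOn_hitDensity_mul_walkProb a j).add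
    (integrableOn_hitDensity_mul_walkProb a (j + 1))

lemma Pfirst_eq (a b : ℕ) :
    Pfirst a b = ∫ t in Set.Ioi (0 : ℝ), hitDensity a t * survival b t := by
  rw [Pfirst, ← integral_const_mul]
  refine setIntegral_congr_fun measurableSet_Ioi fun t (ht : 0 < t) => ?_
  have h : (b : ℝ) * ∫ s in Set.Ioi t, exp (-s) * besselI b s / s = survival b t := by
    rw [← integral_hitDensity b ht.le, ← integral_const_mul]
    exact setIntegral_congr_fun measurableSet_Ioi fun s hs =>
      mul_exp_neg_mul_besselI_div b (ht.trans hs).ne'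
  rw [← h, ← mul_exp_neg_mul_besselI_div a ht.ne']
  ring

lemma Pfirst_self {a : ℕ} (ha : 1 ≤ a) : Pfirst a a = 1 / 2 := by
  have hd (t : ℝ) : HasDerivAt (fun t => -(survival a t ^ 2 / 2))
      (hitDensity a t * survival a t) t := by
    have := (((hasDerivAt_survival a t).pow 2).div_const 2).neg
    convert! this using 1
    push_cast
    ring
  have hl : Tendsto (fun t => -(survival a t ^ 2 / 2)) atTop (𝓝 0) := by
    simpa using (((tendsto_survival_atTop a).pow 2).div_const 2).neg
  rw [Pfirst_eq, integral_Ioi_of_hasDerivAt_of_tendsto' (fun t _ => hd t)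
    (integrableOn_hitDensity_mul_survival a a) hl, survival_at_zero ha]
  norm_num

lemma Pfirst_succ_sub (a b : ℕ) :
    Pfirst a (b + 1) - Pfirst a b = (∫ t in Set.Ioi (0 : ℝ), hitDensity a t * walkProb b t) +
      ∫ t in Set.Ioi (0 : ℝ), hitDensity a t * walkProb (b + 1) t := by
  rw [Pfirst_eq, Pfirst_eq, ← integral_sub (integrableOn_hitDensity_mul_survival _ _)
    (integrableOn_hitDensity_mul_survival _ _),
    ← integral_add (integrableOn_hitDensity_mul_walkProb _ _)
    (integrableOn_hitDensity_mul_walkProb _ _)]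
  congr 1
  ext t
  rw [survival_succ]
  ring

/-- Exponential rate of the Laplace transform of the first passage times at `1 - cos θ`. -/
noncomputable def hitRate (θ : ℝ) : ℝ := 2 * arsinh (sin (θ / 2))

lemma eq_mul_of_linear_recurrence {r : ℝ} (hr0 : 0 < r) (hr1 : r < 1) {x : ℕ → ℝ}
    (hx : ∀ k, x (k + 2) + x k = (r + r⁻¹) * x (k + 1)) {C : ℝ} (hC : ∀ k, |x k| ≤ C) (k : ℕ) :
    x k = r ^ k * x 0 := by
  have hy (k : ℕ) : x (k + 1) - r * x k = r⁻¹ ^ k * (x 1 - r * x 0) := by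
    induction k with
    | zero => simp
    | succ k ih =>
      rw [pow_succ', mul_assoc, ← ih]
      have := hx k
      field_simp at this ⊢
      linarith
  have h0 : x 1 - r * x 0 = 0 := by
    by_contra hne
    have ht : Tendsto (fun k : ℕ => r⁻¹ ^ k * |x 1 - r * x 0|) atTop atTop :=
      (tendsto_pow_atTop_atTop_of_one_lt ((one_lt_inv₀ hr0).2 hr1)).atTop_mul_const
        (abs_pos.2 hne)
    obtain ⟨k, hk⟩ := (ht.eventually_gt_atTop (C + r * C)).exists
    have h1 : r⁻¹ ^ k * |x 1 - r * x 0| = |x (k + 1) - r * x k| := by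
      rw [hy k, abs_mul, abs_of_pos (a := r⁻¹ ^ k) (by positivity)]
    have h2 := abs_sub (x (k + 1)) (r * x k)
    rw [abs_mul, abs_of_pos hr0] at h2
    nlinarith [hC k, hC (k + 1)]
  induction k with
  | zero => simp
  | succ k ih =>
    have := hy k
    rw [h0, mul_zero] at this
    rw [pow_succ', mul_assoc, ← ih]
    linarith

lemma integral_exp_mul_hitDensity_recurrence {s : ℝ} (hs : 0 ≤ s) (k : ℕ) :
    ((∫ t in Set.Ioi (0 : ℝ), hitDensity k t * exp (-(s * t))) +
      ∫ t in Set.Ioi (0 : ℝ), hitDensity (k + 2 : ℕ) t * exp (-(s * t))) / 2 -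
      (1 + s) * ∫ t in Set.Ioi (0 : ℝ), hitDensity (k + 1 : ℕ) t * exp (-(s * t)) =
      if k = 0 then -(1 / 2) else 0 := by
  have hi (k : ℕ) : IntegrableOn (fun t => hitDensity k t * exp (-(s * t))) (Set.Ioi 0) :=
    integrableOn_hitDensity_mul k (by fun_prop) (C := 1) fun t ht => by
      rw [abs_of_pos (exp_pos _), exp_le_one_iff]
      nlinarith
  have hd (t : ℝ) : HasDerivAt (fun t => hitDensity (k + 1 : ℕ) t * exp (-(s * t)))
      ((hitDensity k t * exp (-(s * t)) + hitDensity (k + 2 : ℕ) t * exp (-(s * t))) / 2 -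
        (1 + s) * (hitDensity (k + 1 : ℕ) t * exp (-(s * t)))) t := by
    have hexp : HasDerivAt (fun t => exp (-(s * t))) (exp (-(s * t)) * -s) t := by
      simpa using ((hasDerivAt_id t).const_mul s).neg.exp
    refine ((hasDerivAt_hitDensity (k + 1 : ℕ) t).mul hexp).congr_deriv ?_
    have e1 : ((k + 1 : ℕ) : ℤ) - 1 = k := by push_cast; ring
    have e2 : ((k + 1 : ℕ) : ℤ) + 1 = (k + 2 : ℕ) := by push_cast; ring
    rw [e1, e2]
    ring
  have hl : Tendsto (fun t => hitDensity (k + 1 : ℕ) t * exp (-(s * t))) atTop (𝓝 0) := by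
    refine squeeze_zero_norm' ?_ (tendsto_norm_zero.comp (tendsto_hitDensity_atTop (k + 1 : ℕ)))
    filter_upwards [eventually_ge_atTop 0] with t ht
    rw [norm_mul, Function.comp_apply]
    refine mul_le_of_le_one_right (norm_nonneg _) ?_
    rw [norm_of_nonneg (exp_pos _).le, exp_le_one_iff]
    nlinarith
  have h := integral_Ioi_of_hasDerivAt_of_tendsto' (a := 0) (fun t _ => hd t)
    ((((hi _).add (hi _)).div_const 2).sub ((hi _).const_mul _)) hl
  have e : ∫ t in Set.Ioi (0 : ℝ), ((hitDensity k t * exp (-(s * t)) +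
      hitDensity (k + 2 : ℕ) t * exp (-(s * t))) / 2 -
        (1 + s) * (hitDensity (k + 1 : ℕ) t * exp (-(s * t)))) = _ :=
    integral_sub (((hi k).add (hi (k + 2))).div_const 2) ((hi (k + 1)).const_mul (1 + s))
  rw [e, integral_div, integral_add (hi _) (hi _), integral_const_mul] at h
  rw [h, hitDensity, walkProb_at_zero, walkProb_at_zero]
  rw [if_neg (show ¬ ((k + 1 : ℕ) : ℤ) + 1 = 0 by omega)]
  by_cases hk : k = 0
  · simp [hk]
  · rw [if_neg hk, if_neg (show ¬ ((k + 1 : ℕ) : ℤ) - 1 = 0 by omega)]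
    simp

lemma abs_integral_exp_mul_hitDensity_le {s : ℝ} (hs : 0 ≤ s) {k : ℕ} (hk : 1 ≤ k) :
    |∫ t in Set.Ioi (0 : ℝ), hitDensity k t * exp (-(s * t))| ≤ 1 := by
  have h := integral_hitDensity k le_rfl
  rw [survival_at_zero hk] at h
  rw [← h]
  rw [← norm_eq_abs]
  refine norm_integral_le_of_norm_le (integrableOn_hitDensity k le_rfl) ?_
  filter_upwards [ae_restrict_mem measurableSet_Ioi] with t (ht : 0 < t)
  rw [norm_mul, norm_of_nonneg (hitDensity_nonneg k ht), norm_of_nonneg (exp_pos _).le]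
  refine mul_le_of_le_one_right (hitDensity_nonneg k ht) ?_
  rw [exp_le_one_iff]
  nlinarith

lemma integral_exp_mul_hitDensity {θ : ℝ} (h0 : 0 < θ) (hπ : θ ≤ π) {k : ℕ} (hk : 1 ≤ k) :
    ∫ t in Set.Ioi (0 : ℝ), hitDensity k t * exp (-((1 - cos θ) * t)) =
      exp (-hitRate θ) ^ k := by
  have hs : 0 ≤ 1 - cos θ := by linarith [cos_le_one θ]
  have hσ : 0 < sin (θ / 2) := sin_pos_of_pos_of_lt_pi (by linarith) (by linarith)
  have hrate : 0 < hitRate θ := by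
    have := arsinh_pos_iff.2 hσ
    rw [hitRate]
    linarith
  obtain ⟨L, hL⟩ : ∃ L : ℕ → ℝ, ∀ k, L k =
      ∫ t in Set.Ioi (0 : ℝ), hitDensity k t * exp (-((1 - cos θ) * t)) := ⟨_, fun _ => rfl⟩
  have hL0 : L 0 = 0 := by simp [hL, hitDensity_zero]
  set x : ℕ → ℝ := fun k => if k = 0 then 1 else L k with hx
  have hr : exp (-hitRate θ) + (exp (-hitRate θ))⁻¹ = 2 * (1 + (1 - cos θ)) := by
    have h1 : cosh (hitRate θ) = 1 + 2 * sin (θ / 2) ^ 2 := by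
      rw [hitRate, cosh_two_mul, cosh_sq, sinh_arsinh]
      ring
    have h2 : cos θ = 1 - 2 * sin (θ / 2) ^ 2 := by
      have := cos_two_mul (θ / 2)
      rw [mul_div_cancel₀ _ two_ne_zero] at this
      rw [this, cos_sq']
      ring
    rw [← exp_neg, neg_neg, h2]
    rw [cosh_eq] at h1
    linarith
  have h := eq_mul_of_linear_recurrence (exp_pos _) (exp_lt_one_iff.2 (neg_lt_zero.2 hrate)) (x := x)
    (C := 1) (fun k => ?_) (fun k => ?_) k
  · rw [← hL]
    simpa only [hx, if_neg (Nat.one_le_iff_ne_zero.1 hk), if_true, mul_one] using h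
  · have hrec := integral_exp_mul_hitDensity_recurrence hs k
    rw [← hL, ← hL, ← hL] at hrec
    rw [hr]
    by_cases hk : k = 0
    · subst hk
      rw [if_pos rfl, hL0] at hrec
      simp only [hx, zero_add, OfNat.ofNat_ne_zero, one_ne_zero, if_true, if_false] at hrec ⊢
      linarith
    · rw [if_neg hk] at hrec
      simp only [hx, hk, Nat.add_eq_zero_iff, OfNat.ofNat_ne_zero, one_ne_zero, and_false,
        if_false]
      linarith
  · by_cases hk : k = 0
    · simp [hx, hk]
    · simp only [hx, hk, if_false, hL]
      exact abs_integral_exp_mul_hitDensity_le hs (Nat.one_le_iff_ne_zero.2 hk)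

lemma integral_hitDensity_mul_walkProb {a : ℕ} (ha : 1 ≤ a) (n : ℤ) :
    ∫ t in Set.Ioi (0 : ℝ), hitDensity a t * walkProb n t =
      (1 / π) * ∫ θ in Set.Ioc 0 π, exp (-hitRate θ) ^ a * cos (n * θ) := by
  have hint : Integrable (Function.uncurry fun (t θ : ℝ) => hitDensity a t *
      (exp (-((1 - cos θ) * t)) * cos (n * θ)))
      ((volume.restrict (Set.Ioi 0)).prod (volume.restrict (Set.Ioc 0 π))) := by
    have h1 : Integrable (fun p : ℝ × ℝ => hitDensity a p.1 * (1 : ℝ))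
        ((volume.restrict (Set.Ioi 0)).prod (volume.restrict (Set.Ioc 0 π))) :=
      (integrableOn_hitDensity a le_rfl).mul_prod (integrable_const (1 : ℝ))
    refine h1.mono' ?_ ?_
    · have := continuous_hitDensity a
      exact (by fun_prop : Continuous fun p : ℝ × ℝ => hitDensity a p.1 *
        (exp (-((1 - cos p.2) * p.1)) * cos (n * p.2))).aestronglyMeasurable
    · rw [Measure.prod_restrict]
      filter_upwards [ae_restrict_mem (measurableSet_Ioi.prod measurableSet_Ioc)] with p hp
      have hp1 : 0 < p.1 := hp.1
      simp only [Function.uncurry]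
      rw [norm_mul, norm_of_nonneg (hitDensity_nonneg a hp1), norm_mul]
      refine mul_le_mul_of_nonneg_left ?_ (hitDensity_nonneg a hp1)
      refine mul_le_one₀ ?_ (norm_nonneg _) (by simpa using abs_cos_le_one _)
      rw [norm_of_nonneg (exp_pos _).le, exp_le_one_iff]
      nlinarith [cos_le_one p.2]
  have h1 : ∫ t in Set.Ioi (0 : ℝ), hitDensity a t * walkProb n t =
      (1 / π) * ∫ t in Set.Ioi (0 : ℝ), ∫ θ in Set.Ioc 0 π, hitDensity a t *
        (exp (-((1 - cos θ) * t)) * cos (n * θ)) := by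
    rw [← integral_const_mul]
    congr 1
    ext t
    rw [integral_const_mul, walkProb, intervalIntegral.integral_of_le pi_pos.le]
    simp only [mul_comm t]
    ring
  rw [h1, integral_integral_swap hint]
  congr 1
  refine setIntegral_congr_fun measurableSet_Ioc fun θ hθ => ?_
  simp only [← mul_assoc]
  rw [integral_mul_const, integral_exp_mul_hitDensity hθ.1 hθ.2 ha]

lemma div_two_le_arsinh {x : ℝ} (h0 : 0 ≤ x) (h1 : x ≤ 1) : x / 2 ≤ arsinh x := by
  rw [← exp_le_exp, exp_arsinh]
  have h2 : 1 ≤ √(1 + x ^ 2) := one_le_sqrt.2 (by nlinarith)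
  have h3 : exp (x / 2) ≤ 1 / (1 - x / 2) :=
    exp_bound_div_one_sub_of_interval (by linarith) (by linarith)
  have h4 : 1 / (1 - x / 2) ≤ 1 + x := by
    rw [div_le_iff₀ (by linarith)]
    nlinarith
  linarith

lemma div_pi_le_hitRate {θ : ℝ} (h0 : 0 ≤ θ) (hπ : θ ≤ π) : θ / π ≤ hitRate θ := by
  have h1 := mul_le_sin (x := θ / 2) (by linarith) (by linarith)
  have h2 := div_two_le_arsinh (sin_nonneg_of_nonneg_of_le_pi (x := θ / 2) (by linarith)
    (by linarith)) (sin_le_one _)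
  have h3 : 2 / π * (θ / 2) = θ / π := by ring
  rw [hitRate]
  linarith

lemma hasDerivAt_hitRate_zero : HasDerivAt hitRate 1 0 := by
  have h1 : HasDerivAt (fun θ : ℝ => sin (θ / 2)) (1 / 2) 0 := by
    simpa using ((hasDerivAt_id (0 : ℝ)).div_const 2).sin
  have h2 : HasDerivAt arsinh 1 (sin (0 / 2)) := by
    simpa using hasDerivAt_arsinh (sin (0 / 2))
  have h3 := (h2.comp 0 h1).const_mul 2
  simp only [one_mul, mul_one_div_cancel (two_ne_zero' ℝ)] at h3
  exact h3

lemma tendsto_natCast_mul_hitRate (φ : ℝ) :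
    Tendsto (fun n : ℕ => (n : ℝ) * hitRate (φ / n)) atTop (𝓝 φ) := by
  have h1 : HasDerivAt (fun u : ℝ => hitRate (φ * u)) φ 0 := by
    have h2 : HasDerivAt (fun u : ℝ => φ * u) φ 0 := by
      simpa using (hasDerivAt_id (0 : ℝ)).const_mul φ
    have h3 : HasDerivAt hitRate 1 (φ * 0) := by simpa using hasDerivAt_hitRate_zero
    exact (h3.comp 0 h2).congr_deriv (one_mul φ)
  have h4 : Tendsto (fun n : ℕ => (n : ℝ)⁻¹) atTop (𝓝[≠] 0) :=
    tendsto_nhdsWithin_iff.2 ⟨tendsto_inv_atTop_nhds_zero_nat,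
      (eventually_ge_atTop 1).mono fun n hn => by
        simpa using (by omega : n ≠ 0)⟩
  have h5 := h1.tendsto_slope_zero.comp h4
  refine h5.congr fun n => ?_
  simp [hitRate, div_eq_mul_inv]

lemma integral_exp_neg_mul_cos :
    ∫ φ in Set.Ioi (0 : ℝ), exp (-φ) * cos φ = 1 / 2 := by
  have hd (x : ℝ) : HasDerivAt (fun x => exp (-x) * ((sin x - cos x) / 2))
      (exp (-x) * cos x) x := by
    refine ((hasDerivAt_neg x).exp.mul
      (((hasDerivAt_sin x).sub (hasDerivAt_cos x)).div_const 2)).congr_deriv ?_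
    rw [Pi.sub_apply]
    ring
  have hi : IntegrableOn (fun x : ℝ => exp (-x) * cos x) (Set.Ioi 0) :=
    (integrableOn_exp_neg_Ioi 0).mul_bdd (c := 1) continuous_cos.aestronglyMeasurable
      (ae_of_all _ fun x => abs_cos_le_one x)
  have hl : Tendsto (fun x => exp (-x) * ((sin x - cos x) / 2)) atTop (𝓝 0) := by
    refine squeeze_zero_norm (fun x => ?_) tendsto_exp_neg_atTop_nhds_zero
    rw [norm_mul, norm_of_nonneg (exp_pos _).le]
    refine mul_le_of_le_one_right (exp_pos _).le ?_
    rw [norm_eq_abs, abs_le]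
    constructor <;> linarith [sin_le_one x, cos_le_one x, neg_one_le_sin x, neg_one_le_cos x]
  rw [integral_Ioi_of_hasDerivAt_of_tendsto' (fun x _ => hd x) hi hl]
  norm_num

lemma tendsto_mul_integral_hitDensity_mul_walkProb (d : ℤ) :
    Tendsto (fun n : ℕ => (n : ℝ) *
      ∫ t in Set.Ioi (0 : ℝ), hitDensity n t * walkProb (n + d) t) atTop
      (𝓝 (1 / (2 * π))) := by
  set F : ℕ → ℝ → ℝ := fun n φ => (Set.Ioc 0 (n * π)).indicator
    (fun φ => exp (-hitRate (φ / n)) ^ n * cos ((n + d : ℤ) * (φ / n))) φ with hF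
  have hcont : Continuous hitRate :=
    continuous_const.mul (continuous_arsinh.comp (continuous_sin.comp (continuous_id.div_const 2)))
  have hlim : Tendsto (fun n : ℕ => ∫ φ in Set.Ioi (0 : ℝ), F n φ) atTop
      (𝓝 (∫ φ in Set.Ioi (0 : ℝ), exp (-φ) * cos φ)) := by
    refine tendsto_integral_of_dominated_convergence (fun φ => exp (-π⁻¹ * φ)) (fun n => ?_)
      (exp_neg_integrableOn_Ioi 0 (by positivity)) (fun n => ?_) ?_
    · exact ((by fun_prop : Continuous fun φ : ℝ => exp (-hitRate (φ / n)) ^ n *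
        cos ((n + d : ℤ) * (φ / n))).aestronglyMeasurable).indicator measurableSet_Ioc
    · refine ae_of_all _ fun φ => ?_
      by_cases hφ : φ ∈ Set.Ioc 0 (n * π)
      · have hn : (0 : ℝ) < n := by
          rcases (Nat.cast_nonneg (α := ℝ) n).eq_or_lt with h | h
          · rw [← h, zero_mul] at hφ
            exact absurd hφ.1 (not_lt.2 hφ.2)
          · exact h
        simp only [hF, Set.indicator_of_mem hφ]
        rw [norm_mul]
        refine (mul_le_of_le_one_right (norm_nonneg _) (by simpa using abs_cos_le_one _)).trans ?_
        rw [norm_of_nonneg (by positivity), ← exp_nat_mul, exp_le_exp]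
        have h := div_pi_le_hitRate (θ := φ / n) (by have := hφ.1; positivity)
          (by rw [div_le_iff₀ hn, mul_comm]; exact hφ.2)
        have h' := mul_le_mul_of_nonneg_left h hn.le
        have e : (n : ℝ) * (φ / n / π) = π⁻¹ * φ := by field_simp
        rw [e] at h'
        linarith
      · simp only [hF, Set.indicator_of_notMem hφ, norm_zero]
        exact (exp_pos _).le
    · filter_upwards [ae_restrict_mem measurableSet_Ioi] with φ (hφ : 0 < φ)
      have h1 : Tendsto (fun n : ℕ => exp (-hitRate (φ / n)) ^ n) atTop (𝓝 (exp (-φ))) := by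
        have := (continuous_exp.tendsto _).comp (tendsto_natCast_mul_hitRate φ).neg
        refine this.congr fun n => ?_
        rw [← exp_nat_mul, mul_neg, Function.comp_apply]
      have h2 : Tendsto (fun n : ℕ => cos ((n + d : ℤ) * (φ / n))) atTop (𝓝 (cos φ)) := by
        have h3 : Tendsto (fun n : ℕ => φ + d * φ * (n : ℝ)⁻¹) atTop (𝓝 φ) := by
          simpa using (tendsto_inv_atTop_nhds_zero_nat.const_mul (d * φ)).const_add φ
        refine ((continuous_cos.tendsto _).comp h3).congr' ?_
        filter_upwards [eventually_ge_atTop 1] with n hn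
        have : (n : ℝ) ≠ 0 := by exact_mod_cast (by omega : n ≠ 0)
        rw [Function.comp_apply]
        congr 1
        push_cast
        field_simp
      refine (h1.mul h2).congr' ?_
      obtain ⟨N, hN⟩ := exists_nat_ge (φ / π)
      filter_upwards [eventually_ge_atTop N] with n hn
      have : φ ∈ Set.Ioc 0 (n * π) := by
        refine ⟨hφ, ?_⟩
        rw [div_le_iff₀ pi_pos] at hN
        refine hN.trans ?_
        gcongr
      simp only [hF, Set.indicator_of_mem this]
  rw [integral_exp_neg_mul_cos] at hlim
  have h := hlim.const_mul (1 / π)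
  rw [show 1 / π * (1 / 2) = 1 / (2 * π) by field_simp] at h
  refine h.congr' ?_
  filter_upwards [eventually_ge_atTop 1] with n hn
  have hn' : (n : ℝ) ≠ 0 := by exact_mod_cast (by omega : n ≠ 0)
  rw [integral_hitDensity_mul_walkProb hn, mul_left_comm]
  congr 1
  have hsub := intervalIntegral.integral_comp_div (a := 0) (b := n * π)
    (fun θ => exp (-hitRate θ) ^ n * cos ((n + d : ℤ) * θ)) hn'
  rw [zero_div, mul_div_cancel_left₀ _ hn', intervalIntegral.integral_of_le pi_pos.le,
    intervalIntegral.integral_of_le (by positivity), smul_eq_mul] at hsub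
  rw [← hsub, hF, setIntegral_indicator measurableSet_Ioc,
    Set.inter_eq_right.2 Set.Ioc_subset_Ioi_self]

lemma tendsto_mul_Pfirst_succ_sub (d : ℤ) :
    Tendsto (fun n : ℕ => (n : ℝ) *
      (Pfirst n ((n : ℤ) + (d + 1)).toNat - Pfirst n ((n : ℤ) + d).toNat)) atTop
      (𝓝 (1 / π)) := by
  have h := (tendsto_mul_integral_hitDensity_mul_walkProb d).add
    (tendsto_mul_integral_hitDensity_mul_walkProb (d + 1))
  rw [show 1 / (2 * π) + 1 / (2 * π) = 1 / π by field_simp; norm_num] at h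
  refine h.congr' ?_
  filter_upwards [eventually_ge_atTop (-d).toNat] with n hn
  obtain ⟨b, hb⟩ := Int.eq_ofNat_of_zero_le (by omega : 0 ≤ (n : ℤ) + d)
  have e1 : ((n : ℤ) + d).toNat = b := by omega
  have e2 : ((n : ℤ) + (d + 1)).toNat = b + 1 := by omega
  have e3 : (n : ℤ) + (d + 1) = b + 1 := by omega
  rw [e1, e2, Pfirst_succ_sub, hb, e3, mul_add]

theorem Pfirst_near_diagonal_asymptotics (δ : ℤ) :
    Tendsto (fun ℓ : ℕ => (ℓ : ℝ) * (Pfirst ℓ ((ℓ : ℤ) + δ).toNat - 1 / 2))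
      atTop (nhds ((δ : ℝ) / Real.pi)) := by
  induction δ using Int.induction_on with
  | zero =>
    rw [Int.cast_zero, zero_div]
    refine tendsto_const_nhds.congr' ?_
    filter_upwards [eventually_ge_atTop 1] with n hn
    simp [Pfirst_self hn]
  | succ i ih =>
    have h := ih.add (tendsto_mul_Pfirst_succ_sub i)
    rw [← add_div] at h
    push_cast at h ⊢
    exact h.congr fun n => by ring
  | pred i ih =>
    have h := ih.sub (tendsto_mul_Pfirst_succ_sub (-i - 1))
    rw [← sub_div] at h
    simp only [sub_add_cancel] at h
    push_cast at h ⊢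
    exact h.congr fun n => by ring
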